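/- Let G be a finite group with |CD(G)| = |L(G)| - 1. Then the Chermak-Delgado measure m_G, viewed as a function on the subgroups of G, takes exactly two distinct values; moreover there is a prime p such that G is a p-group and the center of G has order p. -/

import Mathlib

/-- The Chermak-Delgado measure of a subgroup `H` of `G`: `m_G(H) = |H| * |C_G(H)|`. -/
noncomputable def cdMeasure (G : Type*) [Group G] (H : Subgroup G) : ℕ :=
  Nat.card H * Nat.card (Subgroup.centralizer (H : Set G))

/-- The Chermak-Delgado lattice of `G`: the set of subgroups whose Chermak-Delgado
measure is maximal among all subgroups of `G`. -/
def cdLattice (G : Type*) [Group G] : Set (Subgroup G) :=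
  {H | ∀ K : Subgroup G, cdMeasure G K ≤ cdMeasure G H}

section ChermakDelgado

variable {G : Type*} [Group G]

theorem cdMeasure_bot : cdMeasure G ⊥ = Nat.card G := by
  have h : Subgroup.centralizer ((⊥ : Subgroup G) : Set G) = ⊤ :=
    Subgroup.centralizer_eq_top_iff_subset.mpr (bot_le : ⊥ ≤ Subgroup.center G)
  rw [cdMeasure, h, Subgroup.card_bot, one_mul, Subgroup.card_top]

theorem cdMeasure_top :
    cdMeasure G ⊤ = Nat.card G * Nat.card (Subgroup.center G) := by
  simp [cdMeasure, Subgroup.centralizer_univ]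

variable [Finite G]

theorem top_mem_cdLattice_of_bot_mem (h : ⊥ ∈ cdLattice G) : ⊤ ∈ cdLattice G := fun K =>
  (h K).trans <| by
    rw [cdMeasure_bot, cdMeasure_top]
    exact Nat.le_mul_of_pos_right _ Nat.card_pos

theorem center_le_of_mem_cdLattice {H : Subgroup G} (h : H ∈ cdLattice G) :
    Subgroup.center G ≤ H := by
  have hcent : Subgroup.centralizer (H : Set G) ≤
      Subgroup.centralizer ((H ⊔ Subgroup.center G : Subgroup G) : Set G) := by
    rw [Subgroup.le_centralizer_iff]
    refine sup_le ?_ (Subgroup.center_le_centralizer _)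
    rw [Subgroup.le_centralizer_iff]
  have hle := h (H ⊔ Subgroup.center G)
  have hcard : Nat.card (H ⊔ Subgroup.center G : Subgroup G) ≤ Nat.card H :=
    Nat.le_of_mul_le_mul_right
      ((Nat.mul_le_mul_left _ (Subgroup.card_le_of_le hcent)).trans hle) Nat.card_pos
  exact le_sup_right.trans (Subgroup.eq_of_le_of_card_ge le_sup_left hcard).ge

theorem isPGroup_of_unique_prime_dvd {p : ℕ}
    (h : ∀ q : ℕ, q.Prime → q ∣ Nat.card G → q = p) : IsPGroup p G :=
  IsPGroup.of_card
    (Nat.eq_prime_pow_of_unique_prime_dvd Nat.card_pos.ne' fun {q} hq hd => h q hq hd)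

theorem sylow_notMem_cdLattice_of_bot_mem (hbot : ⊥ ∈ cdLattice G) {p : ℕ} [Fact p.Prime]
    (hp : p ∣ Nat.card G) (P : Sylow p G) : (P : Subgroup G) ∉ cdLattice G := by
  intro hP
  have hcard : Nat.card (P : Subgroup G) * Nat.card (Subgroup.centralizer ((P : Subgroup G) : Set G))
      = Nat.card (P : Subgroup G) * (P : Subgroup G).index := by
    rw [Subgroup.card_mul_index, ← cdMeasure_bot (G := G)]
    exact le_antisymm (hbot _) (hP _)
  have hindex := Nat.eq_of_mul_eq_mul_left Nat.card_pos hcard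
  have hpP : p ∣ Nat.card (P : Subgroup G) := P.dvd_card_of_dvd_card hp
  have : Nontrivial (P : Subgroup G) :=
    Finite.one_lt_card_iff_nontrivial.mp
      ((Fact.out : p.Prime).one_lt.trans_le (Nat.le_of_dvd Nat.card_pos hpP))
  have hcenter : Nontrivial (Subgroup.center (P : Subgroup G)) := P.isPGroup'.center_nontrivial
  have hpz : p ∣ Nat.card (Subgroup.center (P : Subgroup G)) := by
    obtain ⟨n, hn, hc⟩ := (P.isPGroup'.to_subgroup (Subgroup.center _)).nontrivial_iff_card.mp hcenter
    exact hc ▸ dvd_pow_self p hn.ne'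
  have hle : (Subgroup.center (P : Subgroup G)).map (P : Subgroup G).subtype ≤
      Subgroup.centralizer ((P : Subgroup G) : Set G) := by
    rintro _ ⟨z, hz, rfl⟩ x hx
    exact congrArg Subtype.val (Subgroup.mem_center_iff.mp hz ⟨x, hx⟩)
  have hdvd := Subgroup.card_dvd_of_le hle
  rw [Subgroup.card_map_of_injective (P : Subgroup G).subtype_injective, hindex] at hdvd
  exact P.not_dvd_index (hpz.trans hdvd)

theorem exists_cdLattice_compl_eq_singleton
    (h : Nat.card (cdLattice G) = Nat.card (Subgroup G) - 1) :
    ∃ H : Subgroup G, (cdLattice G)ᶜ = {H} := by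
  rw [← Set.ncard_eq_one, Set.ncard_compl, ← Nat.card_coe_set_eq, h]
  have : 0 < Nat.card (Subgroup G) := Nat.card_pos
  omega

theorem card_range_cdMeasure_eq_two {H : Subgroup G} (hH : (cdLattice G)ᶜ = {H}) :
    Nat.card (Set.range (cdMeasure G)) = 2 := by
  obtain ⟨M, hM⟩ := Finite.exists_max (cdMeasure G)
  have hHmem : H ∉ cdLattice G := hH.ge rfl
  have hlt : cdMeasure G H ≠ cdMeasure G M := fun heq =>
    hHmem fun K => heq ▸ hM K
  rw [Nat.card_coe_set_eq, ← Set.ncard_pair hlt]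
  congr 1
  ext n
  constructor
  · rintro ⟨K, rfl⟩
    by_cases hK : K ∈ cdLattice G
    · exact Or.inr (le_antisymm (hM K) (hK M))
    · exact Or.inl (congrArg _ (hH.le hK))
  · rintro (rfl | rfl) <;> exact Set.mem_range_self _

theorem bot_notMem_cdLattice {H : Subgroup G} (hH : (cdLattice G)ᶜ = {H}) :
    ⊥ ∉ cdLattice G := by
  intro hbot
  have hHmem : H ∉ cdLattice G := hH.ge rfl
  have hsylow : ∀ q : ℕ, q.Prime → q ∣ Nat.card G → IsPGroup q H := by
    intro q hq hd
    have := Fact.mk hq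
    obtain ⟨Q⟩ : Nonempty (Sylow q G) := inferInstance
    have hQ : (Q : Subgroup G) = H := hH.le (sylow_notMem_cdLattice_of_bot_mem hbot hd Q)
    exact hQ ▸ Q.isPGroup'
  have hH1 : Nat.card H ≠ 1 := fun hc => hHmem (Subgroup.card_eq_one.mp hc ▸ hbot)
  obtain ⟨p, hp, hpH⟩ := Nat.exists_prime_and_dvd hH1
  have := Fact.mk hp
  have hpG : p ∣ Nat.card G := hpH.trans H.card_subgroup_dvd_card
  have hG : IsPGroup p G := isPGroup_of_unique_prime_dvd fun q hq hd => by
    have := Fact.mk hq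
    obtain ⟨n, hn⟩ := IsPGroup.iff_card.mp (hsylow q hq hd)
    exact ((Nat.prime_dvd_prime_iff_eq hp hq).mp (hp.dvd_of_dvd_pow (hn ▸ hpH))).symm
  obtain ⟨P⟩ : Nonempty (Sylow p G) := inferInstance
  have hP : (P : Subgroup G) = ⊤ :=
    (P.is_maximal' (hG.to_subgroup ⊤) le_top).symm
  exact sylow_notMem_cdLattice_of_bot_mem hbot hpG P
    (hP ▸ top_mem_cdLattice_of_bot_mem hbot)

theorem card_center_of_bot_notMem_cdLattice {H : Subgroup G} (hH : (cdLattice G)ᶜ = {H})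
    (hbot : ⊥ ∉ cdLattice G) {p : ℕ} (hp : p.Prime) (hd : p ∣ Nat.card G) :
    Nat.card (Subgroup.center G) = p := by
  have hmem : ∀ K : Subgroup G, K ≠ ⊥ → K ∈ cdLattice G := fun K hK => by
    by_contra hc
    exact hK ((hH.le hc : K = H).trans (hH.le hbot : ⊥ = H).symm)
  have := Fact.mk hp
  obtain ⟨x, hx⟩ := exists_prime_orderOf_dvd_card' p hd
  have hx1 : x ≠ 1 := by
    rintro rfl
    exact hp.one_lt.ne (orderOf_one.symm.trans hx)
  have hle := center_le_of_mem_cdLattice (hmem _ (Subgroup.zpowers_ne_bot.mpr hx1))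
  have hdvd := Subgroup.card_dvd_of_le hle
  rw [Nat.card_zpowers, hx] at hdvd
  refine ((Nat.dvd_prime hp).mp hdvd).resolve_left fun hz => hbot fun K => ?_
  have hne : (⊤ : Subgroup G) ≠ ⊥ := fun ht => hx1 (Subgroup.mem_bot.mp (ht ▸ Subgroup.mem_top x))
  have htop := hmem ⊤ hne K
  rwa [cdMeasure_top, hz, mul_one, ← cdMeasure_bot] at htop

end ChermakDelgado


/-- If a finite group `G` satisfies `|CD(G)| = |L(G)| - 1`, then the Chermak-Delgado
measure takes exactly two distinct values on the subgroups of `G`, and there is a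
prime `p` such that `G` is a `p`-group whose center has order `p`. -/
theorem cd_eq_sub_one_structure (G : Type*) [Group G] [Finite G]
    (h : Nat.card (cdLattice G) = Nat.card (Subgroup G) - 1) :
    Nat.card (Set.range (cdMeasure G)) = 2 ∧
      ∃ p : ℕ, p.Prime ∧ IsPGroup p G ∧ Nat.card (Subgroup.center G) = p := by
  obtain ⟨H, hH⟩ := exists_cdLattice_compl_eq_singleton h
  have hbot := bot_notMem_cdLattice hH
  refine ⟨card_range_cdMeasure_eq_two hH, ?_⟩
  have hcard : Nat.card G ≠ 1 := fun hc => hbot fun K => by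
    have : Subsingleton G := (Nat.card_eq_one_iff_unique.mp hc).1
    rw [Subsingleton.elim K ⊥]
  obtain ⟨p, hp, hd⟩ := Nat.exists_prime_and_dvd hcard
  have hcenter := card_center_of_bot_notMem_cdLattice hH hbot hp hd
  refine ⟨p, hp, isPGroup_of_unique_prime_dvd fun q hq hqd => ?_, hcenter⟩
  exact (card_center_of_bot_notMem_cdLattice hH hbot hq hqd).symm.trans hcenter
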